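/- Let n ≥ 1, let M be an n×n real matrix with nonnegative entries whose rows each sum to 1, let ρ ∈ ℝ^n, and let γ_0, ..., γ_D ∈ (0,1). Then for each d ∈ {0,...,D} the series V_d := Σ_{t=0}^∞ Φ_d(t) M^t ρ converges absolutely, and the value function at depth D satisfies the decomposition V_D = ρ + Σ_{d=0}^D γ_d M V_d. -/

import Mathlib

/-- `Phi γ d t = Σ_{(a_0,...,a_d) ∈ ℕ^{d+1}, a_0+...+a_d = t} ∏_{i=0}^{d} γ_i^{a_i}`. -/
noncomputable def Phi (γ : ℕ → ℝ) (d t : ℕ) : ℝ :=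
  ∑ a ∈ Finset.Nat.antidiagonalTuple (d + 1) t, ∏ i : Fin (d + 1), γ i ^ a i

theorem Phi_zero_left (γ : ℕ → ℝ) (t : ℕ) : Phi γ 0 t = γ 0 ^ t := by
  simp [Phi]

theorem Phi_zero_right (γ : ℕ → ℝ) (d : ℕ) : Phi γ d 0 = 1 := by
  simp [Phi, Finset.Nat.antidiagonalTuple_zero_right]

/-- `Phi γ (d + 1)` is the Cauchy product of `Phi γ d` with the powers of `γ (d + 1)`. -/
theorem Phi_succ_left (γ : ℕ → ℝ) (d t : ℕ) :
    Phi γ (d + 1) t = ∑ p ∈ Finset.HasAntidiagonal.antidiagonal t, Phi γ d p.1 * γ (d + 1) ^ p.2 := by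
  simp only [Phi, Finset.sum_mul]
  rw [Finset.sum_sigma']
  refine Finset.sum_bij'
    (fun a _ => ⟨(∑ i : Fin (d + 1), a i.castSucc, a (Fin.last _)), Fin.init a⟩)
    (fun x _ => Fin.snoc (α := fun _ => ℕ) x.2 x.1.2) ?_ ?_ ?_ ?_ ?_
  · intro a ha
    rw [Finset.Nat.mem_antidiagonalTuple, Fin.sum_univ_castSucc] at ha
    simp [Finset.Nat.mem_antidiagonalTuple, Fin.init, ha]
  · rintro ⟨⟨i, j⟩, b⟩ h
    simp only [Finset.mem_sigma, Finset.HasAntidiagonal.mem_antidiagonal,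
      Finset.Nat.mem_antidiagonalTuple] at h
    rw [Finset.Nat.mem_antidiagonalTuple, Fin.sum_univ_castSucc]
    simp [h.1, h.2]
  · intro a _
    simp
  · rintro ⟨⟨i, j⟩, b⟩ h
    simp only [Finset.mem_sigma, Finset.Nat.mem_antidiagonalTuple] at h
    simp [h.2]
  · intro a _
    rw [Fin.prod_univ_castSucc]
    simp [Fin.init]

theorem Phi_succ_succ (γ : ℕ → ℝ) (d t : ℕ) :
    Phi γ (d + 1) (t + 1) = Phi γ d (t + 1) + γ (d + 1) * Phi γ (d + 1) t := by
  rw [Phi_succ_left, Phi_succ_left, Finset.Nat.sum_antidiagonal_succ', Finset.mul_sum]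
  simp only [pow_zero, mul_one]
  congr 1
  exact Finset.sum_congr rfl fun p _ => by ring

theorem Phi_succ_right (γ : ℕ → ℝ) (d t : ℕ) :
    Phi γ d (t + 1) = ∑ k ∈ Finset.range (d + 1), γ k * Phi γ k t := by
  induction d with
  | zero => simp [Phi_zero_left, pow_succ']
  | succ d ih => rw [Phi_succ_succ, ih, Finset.sum_range_succ _ (d + 1)]

theorem summable_norm_Phi (γ : ℕ → ℝ) (d : ℕ) (hγ : ∀ k ≤ d, |γ k| < 1) :
    Summable fun t => ‖Phi γ d t‖ := by
  have hpow : ∀ k ≤ d, Summable fun t : ℕ => ‖γ k ^ t‖ := fun k hk =>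
    summable_norm_geometric_of_norm_lt_one (hγ k hk)
  induction d with
  | zero => simpa only [Phi_zero_left] using hpow 0 le_rfl
  | succ d ih =>
    simp only [Phi_succ_left]
    exact summable_norm_sum_mul_antidiagonal_of_summable_norm
      (ih (fun k hk => hγ k (by omega)) fun k hk => hpow k (by omega)) (hpow (d + 1) le_rfl)

theorem norm_mulVec_le_of_row_sum_eq_one {ι : Type*} [Fintype ι] {M : Matrix ι ι ℝ}
    (hM0 : ∀ i j, 0 ≤ M i j) (hM1 : ∀ i, ∑ j, M i j = 1) (v : ι → ℝ) :
    ‖M.mulVec v‖ ≤ ‖v‖ := by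
  refine (pi_norm_le_iff_of_nonneg (norm_nonneg v)).2 fun i => ?_
  calc ‖M.mulVec v i‖ ≤ ∑ j, ‖M i j * v j‖ := norm_sum_le _ _
    _ ≤ ∑ j, M i j * ‖v‖ := Finset.sum_le_sum fun j _ => by
        rw [norm_mul, Real.norm_of_nonneg (hM0 i j)]
        exact mul_le_mul_of_nonneg_left (norm_le_pi_norm v j) (hM0 i j)
    _ = ‖v‖ := by rw [← Finset.sum_mul, hM1, one_mul]

theorem norm_pow_mulVec_le_of_row_sum_eq_one {ι : Type*} [Fintype ι] [DecidableEq ι]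
    {M : Matrix ι ι ℝ} (hM0 : ∀ i j, 0 ≤ M i j) (hM1 : ∀ i, ∑ j, M i j = 1)
    (v : ι → ℝ) (t : ℕ) : ‖(M ^ t).mulVec v‖ ≤ ‖v‖ := by
  induction t with
  | zero => simp
  | succ t ih =>
    rw [pow_succ', ← Matrix.mulVec_mulVec]
    exact (norm_mulVec_le_of_row_sum_eq_one hM0 hM1 _).trans ih

/-- appendix value decomposition, finite-state matrix form. The series
`V_d = Σ_t Φ_d(t) M^t ρ` converge absolutely and `V_D = ρ + Σ_{d=0}^D γ_d M V_d`. -/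
theorem stmt3 (n : ℕ) (hn : 1 ≤ n) (M : Matrix (Fin n) (Fin n) ℝ)
    (hM0 : ∀ i j, 0 ≤ M i j) (hM1 : ∀ i, ∑ j, M i j = 1)
    (ρ : Fin n → ℝ) (D : ℕ) (γ : ℕ → ℝ) (hγ : ∀ d ≤ D, 0 < γ d ∧ γ d < 1)
    (V : ℕ → (Fin n → ℝ)) (hV : ∀ d, V d = ∑' t : ℕ, Phi γ d t • (M ^ t).mulVec ρ) :
    (∀ d ≤ D, Summable fun t : ℕ => ‖Phi γ d t • (M ^ t).mulVec ρ‖) ∧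
    V D = ρ + ∑ d ∈ Finset.range (D + 1), γ d • M.mulVec (V d) := by
  have hsum : ∀ d ≤ D, Summable fun t : ℕ => ‖Phi γ d t • (M ^ t).mulVec ρ‖ := fun d hd => by
    have hΦ := summable_norm_Phi γ d fun k hk => by
      obtain ⟨h0, h1⟩ := hγ k (hk.trans hd)
      rwa [abs_of_pos h0]
    refine (hΦ.mul_right ‖ρ‖).of_nonneg_of_le (fun t => norm_nonneg _) fun t => ?_
    rw [norm_smul]
    exact mul_le_mul_of_nonneg_left (norm_pow_mulVec_le_of_row_sum_eq_one hM0 hM1 ρ t)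
      (norm_nonneg _)
  refine ⟨hsum, ?_⟩
  have hterm : ∀ d ∈ Finset.range (D + 1),
      HasSum (fun t : ℕ => γ d • M.mulVec (Phi γ d t • (M ^ t).mulVec ρ))
        (γ d • M.mulVec (V d)) := fun d hd => by
    have h := (hsum d (Nat.lt_succ_iff.1 (Finset.mem_range.1 hd))).of_norm.hasSum
    rw [← hV] at h
    exact (h.map M.mulVecLin M.mulVecLin.continuous_of_finiteDimensional).const_smul (γ d)
  rw [hV D, (hsum D le_rfl).of_norm.tsum_eq_zero_add, ← (hasSum_sum hterm).tsum_eq]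
  congr 1
  · simp [Phi_zero_right]
  · refine tsum_congr fun t => ?_
    rw [Phi_succ_right, Finset.sum_smul]
    refine Finset.sum_congr rfl fun d _ => ?_
    rw [Matrix.mulVec_smul, Matrix.mulVec_mulVec, ← pow_succ', smul_smul]
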